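/- Let t ∈ ℝ and let y ∈ K(w) with |supp(y)| = k, with minimum consecutive partitions supp(y) = A_1 ∪ ⋯ ∪ A_m and comp(supp(y)) = B_1 ∪ ⋯ ∪ B_m. Then (∅, comp(supp(y)), supp(y)) is a minimal valid SCG-tuple with threshold t; moreover, if B_1 ≠ ∅ (equivalently, 1 ∉ supp(y)), then (supp(y), ∅, ∅) is also a minimal valid SCG-tuple with threshold t. -/

import Mathlib

open Finset

/-- Support of a vector, as a finset. -/
noncomputable def suppF {d : ℕ} (x : Fin d → ℝ) : Finset (Fin d) :=
  Finset.univ.filter fun i => x i ≠ 0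

/-- The sum of the `k` first (= `k` largest, since `w` is strictly decreasing)
entries of `w`, i.e. `∑_{j=1}^k w_[j] = ∑_{j=1}^k w_j`. -/
noncomputable def topSum (d k : ℕ) (w : Fin d → ℝ) : ℝ :=
  ∑ i ∈ Finset.univ.filter (fun i : Fin d => (i : ℕ) < k), w i

/-- The `k`-cardinality binary knapsack set
`K(w) := {x ∈ {0,1}^d : ∑ w_i x_i < c(w), |supp x| ≤ k}` with
`c(w) := ∑_{i=1}^k w_i − t`. -/
def Kset (d k : ℕ) (w : Fin d → ℝ) (t : ℝ) : Set (Fin d → ℝ) :=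
  {x | (∀ i, x i = 0 ∨ x i = 1) ∧
       ∑ i, w i * x i < topSum d k w - t ∧
       (suppF x).card ≤ k}

/-- A valid SCG-tuple with threshold `t` (for strictly decreasing `w`, where
`w_[j] = w_j`): (1) `S, N, C` pairwise disjoint with
`|C| = min (k − |S|) (d − |N| − |S|)`; (2) if `C ≠ ∅` then every index `i` with
`w i ≥ min_{j∈C} w j` lies in `S ∪ N ∪ C`; (3) `∑_{j=1}^k w_[j] − ∑_S w − ∑_C w > t`. -/
def ValidSCG (d k : ℕ) (w : Fin d → ℝ) (t : ℝ) (S N C : Finset (Fin d)) : Prop :=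
  (Disjoint S N ∧ Disjoint S C ∧ Disjoint N C) ∧
  C.card = min (k - S.card) (d - N.card - S.card) ∧
  (∀ (hC : C.Nonempty), ∀ i, C.inf' hC w ≤ w i → i ∈ S ∪ N ∪ C) ∧
  topSum d k w - ∑ i ∈ S, w i - ∑ i ∈ C, w i > t

/-- A minimal SCG-tuple. -/
def MinimalSCG (d k : ℕ) (w : Fin d → ℝ) (t : ℝ) (S N C : Finset (Fin d)) : Prop :=
  ValidSCG d k w t S N C ∧
  (N = ∅ ∨ ∀ i ∈ N, ¬ ValidSCG d k w t S (N.erase i) C) ∧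
  (S = ∅ ∨ ∀ i ∈ S, ¬ ValidSCG d k w t (S.erase i) N (insert i C))

/-- The complementary index set `comp(A) := {i : i ∉ A and i < j for some j ∈ A}`. -/
def compSet (d : ℕ) (A : Finset (Fin d)) : Finset (Fin d) :=
  Finset.univ.filter fun i => i ∉ A ∧ ∃ j ∈ A, i < j

theorem stmt_12 (d k : ℕ) (hk1 : 1 ≤ k) (hkd : k ≤ d)
    (w : Fin d → ℝ) (hw : StrictAnti w) (t : ℝ)
    (y : Fin d → ℝ) (hy : y ∈ Kset d k w t) (hcard : (suppF y).card = k)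
    -- `A 1, …, A m` is the minimum consecutive partition of `supp y`:
    (m : ℕ) (hm : 1 ≤ m) (A B : ℕ → Finset (Fin d))
    (hAunion : suppF y = (Finset.Icc 1 m).biUnion A)
    (hAne : ∀ j ∈ Finset.Icc 1 m, (A j).Nonempty)
    (hAcons : ∀ j ∈ Finset.Icc 1 m, ∀ a ∈ A j, ∀ b ∈ A j,
      ∀ l : Fin d, a ≤ l → l ≤ b → l ∈ A j)
    (hgap : ∀ j, 1 ≤ j → j + 1 ≤ m → ∀ a ∈ A j, ∀ b ∈ A (j + 1),
      (a : ℕ) + 1 < (b : ℕ))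
    -- `B 1, …, B m` is the corresponding partition of `comp (supp y)` into gaps:
    (hB1 : B 1 = Finset.univ.filter fun i => ∀ b ∈ A 1, i < b)
    (hB : ∀ j, 2 ≤ j → j ≤ m →
      B j = Finset.univ.filter fun i => (∀ a ∈ A (j - 1), a < i) ∧ ∀ b ∈ A j, i < b) :
    MinimalSCG d k w t ∅ (compSet d (suppF y)) (suppF y) ∧
    (B 1 ≠ ∅ → MinimalSCG d k w t (suppF y) ∅ ∅) := by
  classical
  obtain ⟨hy01, hysum, -⟩ := hy
  have hsum : ∑ i ∈ suppF y, w i = ∑ i, w i * y i := by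
    unfold suppF
    rw [Finset.sum_filter]
    refine Finset.sum_congr rfl fun i _ => ?_
    rcases hy01 i with h | h <;> simp [h]
  have hdisj : Disjoint (compSet d (suppF y)) (suppF y) := by
    rw [Finset.disjoint_left]
    intro i hi
    exact (Finset.mem_filter.1 hi).2.1
  have hcc : (compSet d (suppF y)).card + k ≤ d := by
    have h := Finset.card_le_univ (compSet d (suppF y) ∪ suppF y)
    rw [Finset.card_union_of_disjoint hdisj, hcard, Fintype.card_fin] at h
    exact h
  refine ⟨⟨⟨⟨by simp, by simp, hdisj⟩, ?_, ?_, ?_⟩, Or.inr ?_, Or.inl rfl⟩, ?_⟩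
  · rw [hcard, Finset.card_empty]
    omega
  · intro hC i hi
    obtain ⟨j, hj, hje⟩ := Finset.exists_mem_eq_inf' hC w
    rw [hje, hw.le_iff_ge] at hi
    by_cases hmem : i ∈ suppF y
    · simp [hmem]
    · have hlt : i < j := lt_of_le_of_ne hi (fun h => hmem (h ▸ hj))
      have : i ∈ compSet d (suppF y) :=
        Finset.mem_filter.2 ⟨Finset.mem_univ _, hmem, j, hj, hlt⟩
      simp [this]
  · rw [hsum, Finset.sum_empty]
    linarith
  · rintro i hi ⟨-, -, h2, -⟩
    obtain ⟨-, hmem, j, hj, hlt⟩ := Finset.mem_filter.1 hi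
    have h := h2 ⟨j, hj⟩ i ((Finset.inf'_le w hj).trans (hw hlt).le)
    simp [hmem] at h
  · intro hBne
    obtain ⟨x, hx⟩ := Finset.nonempty_iff_ne_empty.2 hBne
    rw [hB1] at hx
    have hx1 := (Finset.mem_filter.1 hx).2
    have hxA : ∀ j, 1 ≤ j → j ≤ m → ∀ b ∈ A j, x < b := by
      intro j hj
      induction j, hj using Nat.le_induction with
      | base => intro _; exact hx1
      | succ j hj ih =>
        intro hjm b hb
        obtain ⟨a, ha⟩ := hAne j (Finset.mem_Icc.2 ⟨hj, by omega⟩)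
        have h1 := ih (by omega) a ha
        have h2 := hgap j hj hjm a ha b hb
        rw [Fin.lt_def] at h1 ⊢
        omega
    have hxS : ∀ b ∈ suppF y, x < b := by
      intro b hb
      rw [hAunion, Finset.mem_biUnion] at hb
      obtain ⟨j, hj, hb⟩ := hb
      rw [Finset.mem_Icc] at hj
      exact hxA j hj.1 hj.2 b hb
    refine ⟨⟨⟨by simp, by simp, by simp⟩, ?_, ?_, ?_⟩, Or.inl rfl, Or.inr ?_⟩
    · simp [hcard]
    · intro hC
      exact absurd hC (by simp)
    · rw [hsum, Finset.sum_empty]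
      linarith
    · rintro i hi ⟨-, -, h2, -⟩
      have h := h2 ⟨i, Finset.mem_insert_self _ _⟩ x
        ((Finset.inf'_le w (Finset.mem_insert_self i ∅)).trans (hw (hxS i hi)).le)
      have hxs : x ∈ suppF y := by
        simp only [Finset.union_empty, Finset.mem_union, Finset.mem_erase, Finset.mem_insert,
          Finset.notMem_empty, or_false] at h
        rcases h with h | h
        · exact h.2
        · exact h ▸ hi
      exact lt_irrefl _ (hxS x hxs)
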